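/- Let H, G be countable groups each admitting a proper conditionally negative definite function, and let L be a subgroup of G such that there exists a G-invariant, proper, conditionally negative definite kernel on the coset space G/L (G-invariant: κ(g·a, g·b) = κ(a,b); proper: {b ∈ G/L : κ(a,b) ≤ R} is finite for every a ∈ G/L and R ≥ 0). Then the permutational wreath product H ≀_{G/L} G = H^{(G/L)} ⋊ G admits a proper conditionally negative definite function. -/

import Mathlib

open MeasureTheory Function Set
open scoped ENNReal
/-- A conditionally negative definite kernel: symmetric, vanishing on the diagonal,
with `∑ᵢⱼ cᵢcⱼ κ(xᵢ,xⱼ) ≤ 0` whenever `∑ᵢ cᵢ = 0`. -/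
def IsCNDKernel {X : Type*} (κ : X → X → ℝ) : Prop :=
  (∀ x y, κ x y = κ y x) ∧ (∀ x, κ x x = 0) ∧
    ∀ (n : ℕ) (x : Fin n → X) (c : Fin n → ℝ), (∑ i, c i) = 0 →
      ∑ i, ∑ j, c i * c j * κ (x i) (x j) ≤ 0

/-- A conditionally negative definite function on a group. -/
def IsCNDFunction {G : Type*} [Group G] (ψ : G → ℝ) : Prop :=
  IsCNDKernel fun g h => ψ (g⁻¹ * h)

/-- A proper function on a group: sublevel sets are finite. -/
def IsProperFunction {G : Type*} [Group G] (ψ : G → ℝ) : Prop :=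
  ∀ R : ℝ, {g : G | ψ g ≤ R}.Finite
/-- The group of finitely supported functions `X → H` under pointwise multiplication. -/
def FinSuppSubgroup (H : Type*) [Group H] (X : Type*) : Subgroup (X → H) where
  carrier := {w | (Function.mulSupport w).Finite}
  one_mem' := by simpa [Function.mulSupport_one] using Set.finite_empty
  mul_mem' := by
    intro a b ha hb
    exact (ha.union hb).subset (Function.mulSupport_mul a b)
  inv_mem' := by
    intro a ha
    simpa [Function.mulSupport_inv] using ha

/-- The shift action of `G` on finitely supported functions `X → H`, for a `G`-set `X`:
`(g·w)(x) = w(g⁻¹ • x)`. -/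
def wreathShift (H : Type*) [Group H] (X : Type*) (G : Type*) [Group G] [MulAction G X] :
    G →* MulAut (FinSuppSubgroup H X) where
  toFun g :=
    { toFun := fun w => ⟨fun x => (w : X → H) (g⁻¹ • x), by
        refine (w.2.image (fun x => g • x)).subset ?_
        intro x hx
        exact ⟨g⁻¹ • x, hx, by simp⟩⟩
      invFun := fun w => ⟨fun x => (w : X → H) (g • x), by
        refine (w.2.image (fun x => g⁻¹ • x)).subset ?_
        intro x hx
        exact ⟨g • x, hx, by simp⟩⟩
      left_inv := by intro w; apply Subtype.ext; funext x; simp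
      right_inv := by intro w; apply Subtype.ext; funext x; simp
      map_mul' := by intro a b; rfl }
  map_one' := by
    apply MulEquiv.ext; intro w; apply Subtype.ext; funext x; simp
  map_mul' := by
    intro a b
    apply MulEquiv.ext; intro w; apply Subtype.ext; funext x
    simp [mul_smul]

/-- The permutational wreath product `H ≀_X G = H^{(X)} ⋊ G`. -/
abbrev PermWreath (H : Type*) [Group H] (X : Type*) (G : Type*) [Group G] [MulAction G X] :=
  FinSuppSubgroup H X ⋊[wreathShift H X G] G

/-- The standard wreath product `H ≀ G = H^{(G)} ⋊ G`. -/
abbrev StandardWreath (H : Type*) [Group H] (G : Type*) [Group G] := PermWreath H G G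


theorem sum_mul_ite_nonneg_of_partialEquiv {ι : Type*} [Fintype ι] (r : ι → ι → Prop)
    [DecidableRel r] (symm : ∀ i j, r i j → r j i) (trans : ∀ i j k, r i j → r j k → r i k)
    (c : ι → ℝ) : 0 ≤ ∑ i, ∑ j, c i * c j * (if r i j then 1 else 0) := by
  classical
  let cls : ι → Finset ι := fun i => {j | r i j}
  have hrow (i : ι) : ∑ j, c i * c j * (if r i j then 1 else 0) = c i * ∑ j ∈ cls i, c j := by
    simp [cls, Finset.sum_filter, Finset.mul_sum]
  simp_rw [hrow]
  rw [← Finset.sum_fiberwise (Finset.univ) cls]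
  refine Finset.sum_nonneg fun C _ => ?_
  rw [Finset.sum_congr rfl (g := fun i => c i * ∑ j ∈ C, c j)
    (by intro i hi; rw [(Finset.mem_filter.1 hi).2]), ← Finset.sum_mul]
  rcases C.eq_empty_or_nonempty with rfl | ⟨j, hj⟩
  · simp
  by_cases hC : ∃ i, cls i = C
  · obtain ⟨i, rfl⟩ := hC
    have : Finset.univ.filter (fun k => cls k = cls i) = cls i := by
      have hij : r i j := by simpa [cls] using hj
      ext k
      simp only [Finset.mem_filter, Finset.mem_univ, true_and, cls]
      constructor
      · intro h
        have : j ∈ Finset.univ.filter (r k) := by rw [h]; simpa using hij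
        exact trans _ _ _ hij (symm _ _ (by simpa using this))
      · intro h
        ext l
        simp only [Finset.mem_filter, Finset.mem_univ, true_and]
        exact ⟨fun hl => trans _ _ _ h hl, fun hl => trans _ _ _ (symm _ _ h) hl⟩
    rw [this]
    exact mul_self_nonneg _
  · rw [Finset.filter_false_of_mem (fun i _ h => hC ⟨i, h⟩)]
    simp

theorem sum_mul_ultrametric_nonpos {ι : Type*} [Fintype ι] (M : ι → ι → ℝ)
    (symm : ∀ i j, M i j = M j i) (ultra : ∀ i j k, M i k ≤ max (M i j) (M j k))
    (c : ι → ℝ) (hc : ∑ i, c i = 0) : ∑ i, ∑ j, c i * c j * M i j ≤ 0 := by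
  classical
  obtain ⟨A, hA⟩ := (Set.finite_range (fun p : ι × ι => M p.1 p.2)).bddBelow
  obtain ⟨B, hB⟩ := (Set.finite_range (fun p : ι × ι => M p.1 p.2)).bddAbove
  replace hA (i j : ι) : A ≤ M i j := hA ⟨(i, j), rfl⟩
  replace hB (i j : ι) : M i j ≤ B := hB ⟨(i, j), rfl⟩
  have hint (m : ℝ) : IntervalIntegrable (fun t => if m ≤ t then (1 : ℝ) else 0) volume A B := by
    refine Monotone.intervalIntegrable fun s t hst => ?_
    split_ifs <;> linarith
  have hlevel (i j : ι) : B - M i j = ∫ t in A..B, if M i j ≤ t then (1 : ℝ) else 0 := by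
    rw [← intervalIntegral.integral_add_adjacent_intervals (b := M i j),
      intervalIntegral.integral_congr_ae (g := fun _ => 0),
      intervalIntegral.integral_congr (a := M i j) (g := fun _ => 1)]
    · simp
    · intro t ht
      rw [uIcc_of_le (hB i j)] at ht
      simp [ht.1]
    · have : ∀ᵐ t : ℝ, t ≠ M i j := by simp [ae_iff]
      filter_upwards [this] with t hne ht
      rw [uIoc_of_le (hA i j)] at ht
      simp [lt_of_le_of_ne ht.2 hne]
    · exact (hint _).mono_set (by
        rw [uIcc_of_le (hA i j), uIcc_of_le ((hA i j).trans (hB i j))]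
        exact Icc_subset_Icc_right (hB i j))
    · exact (hint _).mono_set (by
        rw [uIcc_of_le (hB i j), uIcc_of_le ((hA i j).trans (hB i j))]
        exact Icc_subset_Icc_left (hA i j))
  have hpos : 0 ≤ ∑ i, ∑ j, c i * c j * (B - M i j) := by
    rcases isEmpty_or_nonempty ι with hι | ⟨⟨i₀⟩⟩
    · simp
    have hrow (i : ι) : IntervalIntegrable
        (fun t => ∑ j, c i * c j * if M i j ≤ t then (1 : ℝ) else 0) volume A B := by
      simpa only [Finset.sum_fn] using
        IntervalIntegrable.sum Finset.univ fun j _ => (hint (M i j)).const_mul (c i * c j)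
    simp_rw [hlevel, ← intervalIntegral.integral_const_mul]
    simp_rw [← intervalIntegral.integral_finsetSum fun j _ => (hint (M _ j)).const_mul (c _ * c j)]
    rw [← intervalIntegral.integral_finsetSum fun i _ => hrow i]
    refine intervalIntegral.integral_nonneg ((hA i₀ i₀).trans (hB i₀ i₀)) fun t _ => ?_
    refine sum_mul_ite_nonneg_of_partialEquiv (fun i j => M i j ≤ t) ?_ ?_ c
    · intro i j h; rwa [symm]
    · intro i j k hij hjk
      exact (ultra i j k).trans (max_le hij hjk)
  have hB0 : ∑ i, ∑ j, c i * c j * B = 0 := by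
    simp_rw [← Finset.sum_mul, ← Finset.mul_sum, hc]
    simp
  simp_rw [mul_sub, Finset.sum_sub_distrib, hB0] at hpos
  linarith

open scoped Matrix in
theorem multivariateGaussian_map_toLpLin {ι ι' : Type*} [Fintype ι] [Fintype ι'] [DecidableEq ι]
    [DecidableEq ι'] {S : Matrix ι ι ℝ} (hS : S.PosSemidef) (T : Matrix ι' ι ℝ) :
    (ProbabilityTheory.multivariateGaussian 0 S).map (Matrix.toLpLin 2 2 T) =
      ProbabilityTheory.multivariateGaussian 0 (T * S * Tᵀ) := by
  have hT : (T * S * Tᵀ).PosSemidef := by simpa using hS.mul_mul_conjTranspose_same T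
  rw [← LinearMap.coe_toContinuousLinearMap']
  apply ProbabilityTheory.IsGaussian.ext
  · simp only [id_eq, ProbabilityTheory.integral_id_multivariateGaussian]
    rw [ContinuousLinearMap.integral_id_map ProbabilityTheory.IsGaussian.integrable_id,
      ProbabilityTheory.integral_id_multivariateGaussian, map_zero]
  · ext x y
    rw [ProbabilityTheory.covarianceBilin_map ProbabilityTheory.IsGaussian.memLp_two_id,
      ProbabilityTheory.covarianceBilin_multivariateGaussian hS,
      ProbabilityTheory.covarianceBilin_multivariateGaussian hT]
    have hadj (z : EuclideanSpace ℝ ι') :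
        (LinearMap.toContinuousLinearMap (Matrix.toLpLin 2 2 T)).adjoint z =
          Matrix.toLpLin 2 2 Tᵀ z := by
      rw [← LinearMap.adjoint_toContinuousLinearMap, ← Matrix.conjTranspose_eq_transpose_of_trivial,
        Matrix.toEuclideanLin_conjTranspose_eq_adjoint]
      rfl
    simp only [hadj, Matrix.toLpLin_apply]
    rw [Matrix.mulVec_transpose, ← Matrix.dotProduct_mulVec, Matrix.mulVec_mulVec,
      Matrix.mulVec_mulVec, Matrix.mul_assoc]

/-- The orthogonal projection of `ℝ^ι` onto the vectors with zero sum. -/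
noncomputable def centeringMatrix (ι : Type*) [Fintype ι] [DecidableEq ι] : Matrix ι ι ℝ :=
  1 - Matrix.of fun _ _ => (Fintype.card ι : ℝ)⁻¹

open scoped Matrix in
theorem centeringMatrix_transpose (ι : Type*) [Fintype ι] [DecidableEq ι] :
    (centeringMatrix ι)ᵀ = centeringMatrix ι := by
  ext i j
  simp [centeringMatrix, Matrix.one_apply, eq_comm]

open scoped Matrix in
theorem centeringMatrix_mulVec {ι : Type*} [Fintype ι] [DecidableEq ι] (x : ι → ℝ) (i : ι) :
    (centeringMatrix ι *ᵥ x) i = x i - (Fintype.card ι : ℝ)⁻¹ * ∑ j, x j := by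
  simp [centeringMatrix, Matrix.mulVec, dotProduct, sub_mul, Matrix.one_apply, Finset.mul_sum]

open scoped Matrix in
theorem sum_centeringMatrix_mulVec {ι : Type*} [Fintype ι] [DecidableEq ι] (x : ι → ℝ) :
    ∑ i, (centeringMatrix ι *ᵥ x) i = 0 := by
  rcases isEmpty_or_nonempty ι
  · simp
  · simp [centeringMatrix_mulVec, Finset.sum_sub_distrib]

theorem centeringMatrix_mul_submatrix_mul_centeringMatrix {ι ι' : Type*} [Fintype ι] [Fintype ι']
    [DecidableEq ι] [DecidableEq ι'] (u : ι' → ι) :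
    centeringMatrix ι' * (1 : Matrix ι ι ℝ).submatrix u id * centeringMatrix ι =
      centeringMatrix ι' * (1 : Matrix ι ι ℝ).submatrix u id := by
  have h : centeringMatrix ι' * Matrix.of (fun (_ : ι') (_ : ι) => (Fintype.card ι : ℝ)⁻¹) = 0 := by
    ext i j
    have : Nonempty ι' := ⟨i⟩
    simp [centeringMatrix, Matrix.mul_apply, ← Finset.sum_mul, Matrix.one_apply]
  have h' : (1 : Matrix ι ι ℝ).submatrix u id * centeringMatrix ι =
      (1 : Matrix ι ι ℝ).submatrix u id -
        Matrix.of (fun (_ : ι') (_ : ι) => (Fintype.card ι : ℝ)⁻¹) := by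
    ext i j
    simp [centeringMatrix, Matrix.mul_apply, Matrix.one_apply]
  rw [Matrix.mul_assoc, h', Matrix.mul_sub, h, sub_zero]

/-- The covariance matrix of the centred process on `ι` whose increments have variances `k`. -/
noncomputable def centeredCovariance {ι : Type*} [Fintype ι] [DecidableEq ι] (k : ι → ι → ℝ) :
    Matrix ι ι ℝ :=
  (-1 / 2 : ℝ) • (centeringMatrix ι * Matrix.of k * centeringMatrix ι)

open scoped Matrix in
theorem centeredCovariance_comp {ι ι' : Type*} [Fintype ι] [Fintype ι'] [DecidableEq ι]
    [DecidableEq ι'] (k : ι → ι → ℝ) (u : ι' → ι) :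
    centeredCovariance (fun a b => k (u a) (u b)) =
      (centeringMatrix ι' * (1 : Matrix ι ι ℝ).submatrix u id) * centeredCovariance k *
        (centeringMatrix ι' * (1 : Matrix ι ι ℝ).submatrix u id)ᵀ := by
  have hk : (Matrix.of fun a b => k (u a) (u b)) =
      (1 : Matrix ι ι ℝ).submatrix u id * Matrix.of k * ((1 : Matrix ι ι ℝ).submatrix u id)ᵀ := by
    ext a b
    simp [Matrix.mul_apply, Matrix.one_apply]
  have hT := centeringMatrix_mul_submatrix_mul_centeringMatrix u
  have hT' := congrArg Matrix.transpose hT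
  rw [Matrix.transpose_mul _ (centeringMatrix ι), centeringMatrix_transpose] at hT'
  rw [centeredCovariance, centeredCovariance, hk, Matrix.mul_smul, Matrix.smul_mul]
  congr 1
  rw [show ∀ T : Matrix ι' ι ℝ, T * (centeringMatrix ι * Matrix.of k * centeringMatrix ι) * Tᵀ =
      (T * centeringMatrix ι) * Matrix.of k * (centeringMatrix ι * Tᵀ) from
        fun T => by simp only [Matrix.mul_assoc], hT, hT', Matrix.transpose_mul,
    centeringMatrix_transpose]
  simp only [Matrix.mul_assoc]

open scoped Matrix in
theorem dotProduct_centeredCovariance_mulVec {ι : Type*} [Fintype ι] [DecidableEq ι]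
    (k : ι → ι → ℝ) (x : ι → ℝ) :
    x ⬝ᵥ centeredCovariance k *ᵥ x = -1 / 2 * ∑ i, ∑ j,
      (centeringMatrix ι *ᵥ x) i * (centeringMatrix ι *ᵥ x) j * k i j := by
  rw [centeredCovariance, Matrix.smul_mulVec, dotProduct_smul, ← Matrix.mulVec_mulVec,
    ← Matrix.mulVec_mulVec, Matrix.dotProduct_mulVec, ← Matrix.mulVec_transpose,
    centeringMatrix_transpose, smul_eq_mul]
  congr 1
  refine Finset.sum_congr rfl fun i _ => ?_
  change _ * ∑ j, k i j * (centeringMatrix ι *ᵥ x) j = _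
  rw [Finset.mul_sum]
  refine Finset.sum_congr rfl fun j _ => ?_
  ring

theorem centeredCovariance_posSemidef {ι : Type*} [Fintype ι] [DecidableEq ι] {k : ι → ι → ℝ}
    (symm : ∀ i j, k i j = k j i)
    (hk : ∀ c : ι → ℝ, ∑ i, c i = 0 → ∑ i, ∑ j, c i * c j * k i j ≤ 0) :
    (centeredCovariance k).PosSemidef := by
  refine .of_dotProduct_mulVec_nonneg ?_ fun x => ?_
  · have : (Matrix.of k).transpose = Matrix.of k := by ext i j; simp [symm i j]
    rw [Matrix.IsHermitian, Matrix.conjTranspose_eq_transpose_of_trivial, centeredCovariance,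
      Matrix.transpose_smul, Matrix.transpose_mul, Matrix.transpose_mul, this,
      centeringMatrix_transpose, Matrix.mul_assoc]
  · rw [star_trivial, dotProduct_centeredCovariance_mulVec]
    have := hk _ (sum_centeringMatrix_mulVec x)
    linarith

theorem norm_iSup_comp_le {ι ι' : Type*} [Fintype ι] [Finite ι'] [Nonempty ι'] (u : ι' → ι)
    (f : EuclideanSpace ℝ ι) : ‖⨆ a, f (u a)‖ ≤ ‖f‖ := by
  obtain ⟨a, ha⟩ := exists_eq_ciSup_of_finite (f := fun a => f (u a))
  rw [← ha]
  exact PiLp.norm_apply_le f (u a)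

theorem integrable_iSup_comp {ι ι' : Type*} [Fintype ι] [Finite ι'] [Nonempty ι'] (u : ι' → ι)
    (μ : Measure (EuclideanSpace ℝ ι)) [ProbabilityTheory.IsGaussian μ] :
    Integrable (fun f : EuclideanSpace ℝ ι => ⨆ a, f (u a)) μ := by
  refine (ProbabilityTheory.IsGaussian.integrable_id (μ := μ)).norm.mono' ?_
    (.of_forall (norm_iSup_comp_le u))
  exact (Measurable.iSup fun a => by fun_prop).aestronglyMeasurable

theorem integrable_eval_of_isGaussian {ι : Type*} [Fintype ι] (i : ι)
    (μ : Measure (EuclideanSpace ℝ ι)) [ProbabilityTheory.IsGaussian μ] :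
    Integrable (fun f : EuclideanSpace ℝ ι => f i) μ := by
  simpa using integrable_iSup_comp (fun _ : Unit => i) μ

theorem integral_eval_multivariateGaussian_zero {ι : Type*} [Fintype ι] [DecidableEq ι]
    (S : Matrix ι ι ℝ) (i : ι) :
    ∫ f, f i ∂(ProbabilityTheory.multivariateGaussian 0 S) = 0 := by
  have := (EuclideanSpace.proj i : StrongDual ℝ (EuclideanSpace ℝ ι)).integral_comp_id_comm
    (ProbabilityTheory.IsGaussian.integrable_id
      (μ := ProbabilityTheory.multivariateGaussian 0 S))
  simpa using this

/-- The expected maximum of a centred Gaussian process on `ι` whose increments have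
variances `k`. -/
noncomputable def gaussianMax {ι : Type*} [Fintype ι] [DecidableEq ι] (k : ι → ι → ℝ) : ℝ :=
  ∫ f, ⨆ i, f i ∂(ProbabilityTheory.multivariateGaussian 0 (centeredCovariance k))

theorem gaussianMax_comp {ι ι' : Type*} [Fintype ι] [DecidableEq ι] [Fintype ι'] [DecidableEq ι']
    [Nonempty ι'] {k : ι → ι → ℝ} (hk : (centeredCovariance k).PosSemidef) (u : ι' → ι) :
    gaussianMax (fun a b => k (u a) (u b)) =
      ∫ f, ⨆ a, f (u a) ∂(ProbabilityTheory.multivariateGaussian 0 (centeredCovariance k)) := by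
  have happly (f : EuclideanSpace ℝ ι) (a : ι') :
      Matrix.toLpLin 2 2 (centeringMatrix ι' * (1 : Matrix ι ι ℝ).submatrix u id) f a =
        f (u a) - (Fintype.card ι' : ℝ)⁻¹ * ∑ b, f (u b) := by
    rw [Matrix.toLpLin_apply, ← Matrix.mulVec_mulVec]
    simp only [centeringMatrix_mulVec]
    simp [Matrix.mulVec, dotProduct, Matrix.one_apply]
  rw [gaussianMax, centeredCovariance_comp k u, ← multivariateGaussian_map_toLpLin hk,
    ← LinearMap.coe_toContinuousLinearMap', integral_map (by fun_prop)
      (Measurable.iSup fun a => by fun_prop).aestronglyMeasurable]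
  simp only [LinearMap.coe_toContinuousLinearMap', happly]
  simp_rw [← ciSup_sub (Finite.bddAbove_range _)]
  rw [integral_sub (integrable_iSup_comp u _), integral_const_mul,
    integral_finsetSum _ fun b _ => integrable_eval_of_isGaussian (u b)
      (ProbabilityTheory.multivariateGaussian 0 (centeredCovariance k))]
  · simp [integral_eval_multivariateGaussian_zero]
  · exact (integrable_finsetSum _ fun b _ => integrable_eval_of_isGaussian (u b)
      (ProbabilityTheory.multivariateGaussian 0 (centeredCovariance k))).const_mul _

theorem integral_abs_gaussianReal (v : NNReal) :
    ∫ x, |x| ∂(ProbabilityTheory.gaussianReal 0 v) =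
      √v * ∫ x, |x| ∂(ProbabilityTheory.gaussianReal 0 1) := by
  have h : ProbabilityTheory.gaussianReal 0 v =
      (ProbabilityTheory.gaussianReal 0 1).map (√v * ·) := by
    rw [ProbabilityTheory.gaussianReal_map_const_mul]
    congr 1
    · simp
    · ext; simp
  rw [h, integral_map (by fun_prop) (by fun_prop)]
  simp_rw [abs_mul, integral_const_mul, abs_of_nonneg (Real.sqrt_nonneg _)]

theorem integral_abs_gaussianReal_pos : 0 < ∫ x, |x| ∂(ProbabilityTheory.gaussianReal 0 1) := by
  have hint : Integrable (fun x : ℝ => |x|) (ProbabilityTheory.gaussianReal 0 1) :=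
    (ProbabilityTheory.IsGaussian.integrable_id
      (μ := ProbabilityTheory.gaussianReal 0 1)).norm
  refine (integral_nonneg fun x => abs_nonneg x).lt_of_ne' fun h => ?_
  rw [integral_eq_zero_iff_of_nonneg (fun x => abs_nonneg x) hint] at h
  have hvar := ProbabilityTheory.variance_id_gaussianReal (μ := 0) (v := 1)
  rw [ProbabilityTheory.variance_congr (Y := 0) (h.mono fun x hx => by simpa using hx),
    ProbabilityTheory.variance_zero] at hvar
  simp at hvar

theorem variance_sub_centeredCovariance {ι : Type*} [Fintype ι] [DecidableEq ι] {k : ι → ι → ℝ}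
    (hk : (centeredCovariance k).PosSemidef) (symm : ∀ i j, k i j = k j i) (diag : ∀ i, k i i = 0)
    (i j : ι) :
    ProbabilityTheory.variance (fun f : EuclideanSpace ℝ ι => f i - f j)
      (ProbabilityTheory.multivariateGaussian 0 (centeredCovariance k)) = k i j := by
  let x : EuclideanSpace ℝ ι := EuclideanSpace.single i 1 - EuclideanSpace.single j 1
  have hx : (centeringMatrix ι).mulVec x = x.ofLp := by
    ext l; simp [centeringMatrix_mulVec, x, Pi.single_apply]
  have h := ProbabilityTheory.covarianceBilin_self (ProbabilityTheory.IsGaussian.memLp_two_id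
    (μ := ProbabilityTheory.multivariateGaussian 0 (centeredCovariance k))) x
  rw [ProbabilityTheory.covarianceBilin_multivariateGaussian hk,
    dotProduct_centeredCovariance_mulVec, hx] at h
  have hinner : (fun f : EuclideanSpace ℝ ι => inner ℝ x f) = fun f => f i - f j := by
    ext f; simp [x, inner_sub_left, EuclideanSpace.inner_single_left]
  rw [← hinner, ← h]
  simp [x, sub_mul, mul_sub, Finset.sum_sub_distrib, diag, symm j i]
  ring

theorem sqrt_mul_le_gaussianMax {ι : Type*} [Fintype ι] [DecidableEq ι] {k : ι → ι → ℝ}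
    (hk : (centeredCovariance k).PosSemidef) (symm : ∀ i j, k i j = k j i) (diag : ∀ i, k i i = 0)
    (i j : ι) :
    √(k i j) * ((∫ x, |x| ∂(ProbabilityTheory.gaussianReal 0 1)) / 2) ≤ gaussianMax k := by
  set γ := ProbabilityTheory.multivariateGaussian 0 (centeredCovariance k) with hγ
  have hi := integrable_eval_of_isGaussian i γ
  have hj := integrable_eval_of_isGaussian j γ
  have hlaw : γ.map (fun f => f i - f j) =
      ProbabilityTheory.gaussianReal 0 (k i j).toNNReal := by
    have h := ProbabilityTheory.IsGaussian.map_eq_gaussianReal (μ := γ)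
      ((EuclideanSpace.proj i : StrongDual ℝ (EuclideanSpace ℝ ι)) - EuclideanSpace.proj j)
    have hfun : ⇑((EuclideanSpace.proj i : StrongDual ℝ (EuclideanSpace ℝ ι)) -
          (EuclideanSpace.proj j : StrongDual ℝ (EuclideanSpace ℝ ι))) =
        fun f : EuclideanSpace ℝ ι => f i - f j := by ext f; simp
    rwa [hfun, variance_sub_centeredCovariance hk symm diag, integral_sub hi hj,
      integral_eval_multivariateGaussian_zero, integral_eval_multivariateGaussian_zero,
      sub_zero] at h
  have habs : ∫ f, |f i - f j| ∂γ = √(k i j) * ∫ x, |x| ∂(ProbabilityTheory.gaussianReal 0 1) := by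
    have h := integral_abs_gaussianReal (k i j).toNNReal
    rw [← hlaw, integral_map (by fun_prop) (by fun_prop)] at h
    rw [h]
    rcases le_total 0 (k i j) with h₀ | h₀
    · rw [Real.coe_toNNReal _ h₀]
    · simp [Real.toNNReal_of_nonpos h₀, Real.sqrt_eq_zero_of_nonpos h₀]
  have : Nonempty ι := ⟨i⟩
  have hsum : Integrable (fun f => f i + f j) γ := hi.add hj
  have hdiff : Integrable (fun f => |f i - f j|) γ := (hi.sub hj).abs
  have hmono : ∫ f, (f i + f j + |f i - f j|) / 2 ∂γ ≤ gaussianMax k := by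
    refine integral_mono ((hsum.add hdiff).div_const 2)
      (integrable_iSup_comp id γ) fun f => ?_
    have h₁ := Finite.le_ciSup f.ofLp i
    have h₂ := Finite.le_ciSup f.ofLp j
    change (f i + f j + |f i - f j|) / 2 ≤ ⨆ l, f l
    rcases abs_cases (f i - f j) with h | h <;> linarith
  rw [integral_div, integral_add hsum hdiff, integral_add hi hj,
    integral_eval_multivariateGaussian_zero, integral_eval_multivariateGaussian_zero, habs] at hmono
  linarith

theorem IsCNDKernel.sum_nonpos {X ι : Type*} [Fintype ι] {κ : X → X → ℝ} (hκ : IsCNDKernel κ)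
    (x : ι → X) (c : ι → ℝ) (hc : ∑ i, c i = 0) :
    ∑ i, ∑ j, c i * c j * κ (x i) (x j) ≤ 0 := by
  let e := (Fintype.equivFin ι).symm
  have h := hκ.2.2 _ (x ∘ e) (c ∘ e) (by rw [← hc, ← e.sum_comp]; rfl)
  rw [← e.sum_comp]
  simp_rw [← e.sum_comp (fun j => _ * c j * κ _ (x j))]
  exact h

theorem IsCNDKernel.nonneg {X : Type*} {κ : X → X → ℝ} (hκ : IsCNDKernel κ) (x y : X) :
    0 ≤ κ x y := by
  have h := hκ.2.2 2 ![x, y] ![1, -1] (by simp)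
  simp [Fin.sum_univ_two, hκ.2.1, hκ.1 y x] at h
  linarith

theorem IsCNDKernel.comp {X Y : Type*} {κ : X → X → ℝ} (hκ : IsCNDKernel κ) (u : Y → X) :
    IsCNDKernel fun a b => κ (u a) (u b) :=
  ⟨fun _ _ => hκ.1 _ _, fun _ => hκ.2.1 _, fun n x => hκ.2.2 n (u ∘ x)⟩

theorem IsCNDKernel.add {X : Type*} {κ κ' : X → X → ℝ} (hκ : IsCNDKernel κ)
    (hκ' : IsCNDKernel κ') : IsCNDKernel fun a b => κ a b + κ' a b := by
  refine ⟨fun x y => congrArg₂ _ (hκ.1 x y) (hκ'.1 x y),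
    fun x => by simp [hκ.2.1, hκ'.2.1],
    fun n x c hc => ?_⟩
  simp_rw [mul_add, Finset.sum_add_distrib]
  exact add_nonpos (hκ.2.2 n x c hc) (hκ'.2.2 n x c hc)

theorem IsCNDFunction.add {G : Type*} [Group G] {ψ ψ' : G → ℝ} (hψ : IsCNDFunction ψ)
    (hψ' : IsCNDFunction ψ') : IsCNDFunction fun g => ψ g + ψ' g :=
  IsCNDKernel.add hψ hψ'

theorem IsCNDFunction.nonneg {G : Type*} [Group G] {ψ : G → ℝ} (hψ : IsCNDFunction ψ) (g : G) :
    0 ≤ ψ g := by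
  simpa using IsCNDKernel.nonneg hψ 1 g

theorem IsCNDFunction.map_one {G : Type*} [Group G] {ψ : G → ℝ} (hψ : IsCNDFunction ψ) :
    ψ 1 = 0 := by
  simpa using hψ.2.1 1

/-- The expected maximum over `F` of a Gaussian process whose increments have variances `κ`. -/
noncomputable def gaussianWidth {X : Type*} [DecidableEq X] (κ : X → X → ℝ) (F : Finset X) : ℝ :=
  gaussianMax fun a b : F => κ a b

theorem IsCNDKernel.centeredCovariance_posSemidef {X ι : Type*} [Fintype ι] [DecidableEq ι]
    {κ : X → X → ℝ} (hκ : IsCNDKernel κ) (x : ι → X) :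
    (centeredCovariance fun a b => κ (x a) (x b)).PosSemidef :=
  _root_.centeredCovariance_posSemidef (fun _ _ => hκ.1 _ _) (hκ.sum_nonpos x)

theorem gaussianWidth_eq_integral {X : Type*} [DecidableEq X] {κ : X → X → ℝ}
    (hκ : IsCNDKernel κ) {F Y : Finset X} (hF : F.Nonempty) (hFY : F ⊆ Y) :
    gaussianWidth κ F = ∫ f, ⨆ a : F, f ⟨a, hFY a.2⟩
      ∂(ProbabilityTheory.multivariateGaussian 0 (centeredCovariance fun a b : Y => κ a b)) := by
  have : Nonempty F := hF.to_subtype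
  exact gaussianMax_comp (hκ.centeredCovariance_posSemidef (Subtype.val : Y → X))
    fun a : F => (⟨a, hFY a.2⟩ : Y)

theorem gaussianWidth_image {X : Type*} [DecidableEq X] {κ : X → X → ℝ} (hκ : IsCNDKernel κ)
    {F : Finset X} (hF : F.Nonempty) {e : X → X} (he : ∀ a b, κ (e a) (e b) = κ a b) :
    gaussianWidth κ (F.image e) = gaussianWidth κ F := by
  have : Nonempty F := hF.to_subtype
  let u : F → F.image e := fun a => ⟨e a, Finset.mem_image_of_mem e a.2⟩
  have hu : Surjective u := by
    rintro ⟨b, hb⟩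
    obtain ⟨a, ha, rfl⟩ := Finset.mem_image.1 hb
    exact ⟨⟨a, ha⟩, rfl⟩
  have h := gaussianMax_comp
    (hκ.centeredCovariance_posSemidef (Subtype.val : F.image e → X)) u
  simp_rw [u, he] at h
  rw [gaussianWidth, gaussianWidth, h, gaussianMax]
  congr 1
  ext f
  exact (hu.iSup_comp f.ofLp).symm

theorem gaussianWidth_singleton {X : Type*} [DecidableEq X] (κ : X → X → ℝ) (a : X) :
    gaussianWidth κ {a} = 0 := by
  have h (f : EuclideanSpace ℝ ({a} : Finset X)) :
      ⨆ i, f i = f ⟨a, Finset.mem_singleton_self a⟩ := by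
    have : Unique ({a} : Finset X) := inferInstance
    rw [ciSup_unique]
    exact congrArg _ (Subsingleton.elim _ _)
  simp_rw [gaussianWidth, gaussianMax, h]
  exact integral_eval_multivariateGaussian_zero _ _

theorem sqrt_mul_le_gaussianWidth {X : Type*} [DecidableEq X] {κ : X → X → ℝ}
    (hκ : IsCNDKernel κ) {F : Finset X} {a b : X} (ha : a ∈ F) (hb : b ∈ F) :
    √(κ a b) * ((∫ x, |x| ∂(ProbabilityTheory.gaussianReal 0 1)) / 2) ≤ gaussianWidth κ F :=
  sqrt_mul_le_gaussianMax (hκ.centeredCovariance_posSemidef (Subtype.val : F → X))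
    (fun _ _ => hκ.1 _ _) (fun _ => hκ.2.1 _) ⟨a, ha⟩ ⟨b, hb⟩

/-- The support of `w`, as a finset. -/
noncomputable def finSupp {H X : Type*} [Group H] (w : FinSuppSubgroup H X) : Finset X :=
  Set.Finite.toFinset (s := mulSupport (w : X → H)) w.2

theorem mem_finSupp {H X : Type*} [Group H] {w : FinSuppSubgroup H X} {x : X} :
    x ∈ finSupp w ↔ (w : X → H) x ≠ 1 :=
  Set.Finite.mem_toFinset (s := mulSupport (w : X → H)) w.2

/-- The base points `p.2`, `q.2` together with the places where `p.1` and `q.1` differ. -/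
noncomputable def separationSet {H X : Type*} [Group H] [DecidableEq X]
    (p q : FinSuppSubgroup H X × X) : Finset X :=
  insert p.2 (insert q.2 (finSupp (p.1⁻¹ * q.1)))

theorem mem_separationSet {H X : Type*} [Group H] [DecidableEq X]
    {p q : FinSuppSubgroup H X × X} {x : X} :
    x ∈ separationSet p q ↔ x = p.2 ∨ x = q.2 ∨ (p.1 : X → H) x ≠ (q.1 : X → H) x := by
  simp [separationSet, mem_finSupp, inv_mul_eq_one]

theorem separationSet_nonempty {H X : Type*} [Group H] [DecidableEq X]
    (p q : FinSuppSubgroup H X × X) : (separationSet p q).Nonempty :=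
  Finset.insert_nonempty _ _

theorem isCNDKernel_gaussianWidth_separationSet {H X : Type*} [Group H] [DecidableEq X]
    {κ : X → X → ℝ} (hκ : IsCNDKernel κ) :
    IsCNDKernel fun p q : FinSuppSubgroup H X × X => gaussianWidth κ (separationSet p q) := by
  have hsymm (p q : FinSuppSubgroup H X × X) : separationSet p q = separationSet q p := by
    ext x
    simp only [mem_separationSet, ne_comm (a := (p.1 : X → H) x)]
    tauto
  refine ⟨fun p q => congrArg _ (hsymm p q), fun p => ?_, fun n p c hc => ?_⟩
  · have : separationSet p p = {p.2} := by ext x; simp [mem_separationSet]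
    exact (congrArg _ this).trans (gaussianWidth_singleton κ p.2)
  let F : Fin n → Fin n → Finset X := fun i j => separationSet (p i) (p j)
  let Y : Finset X := Finset.univ.biUnion fun i => Finset.univ.biUnion (F i)
  have hFY (i j : Fin n) : F i j ⊆ Y :=
    (Finset.subset_biUnion_of_mem (F i) (Finset.mem_univ j)).trans
      (Finset.subset_biUnion_of_mem (fun i => Finset.univ.biUnion (F i)) (Finset.mem_univ i))
  have hne (i j : Fin n) : Nonempty (F i j) := (separationSet_nonempty _ _).to_subtype
  let γ := ProbabilityTheory.multivariateGaussian 0 (centeredCovariance fun a b : Y => κ a b)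
  let M : Fin n → Fin n → EuclideanSpace ℝ Y → ℝ := fun i j f => ⨆ a : F i j, f ⟨a, hFY i j a.2⟩
  have hM (i j : Fin n) : Integrable (M i j) γ :=
    integrable_iSup_comp (fun a : F i j => (⟨a, hFY i j a.2⟩ : Y)) γ
  have hle (f : EuclideanSpace ℝ Y) (i j : Fin n) (x : X) (hx : x ∈ F i j) :
      f ⟨x, hFY i j hx⟩ ≤ M i j f :=
    Finite.le_ciSup (fun a : F i j => f ⟨a, hFY i j a.2⟩) ⟨x, hx⟩
  have hMsymm (f : EuclideanSpace ℝ Y) (i j : Fin n) : M i j f ≤ M j i f :=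
    ciSup_le fun a => hle f j i a (by simpa only [F, hsymm (p j)] using a.2)
  have hint : ∑ i, ∑ j, c i * c j * gaussianWidth κ (F i j) =
      ∫ f, ∑ i, ∑ j, c i * c j * M i j f ∂γ := by
    rw [integral_finsetSum _ fun i _ => integrable_finsetSum _ fun j _ => (hM i j).const_mul _]
    refine Finset.sum_congr rfl fun i _ => ?_
    rw [integral_finsetSum _ fun j _ => (hM i j).const_mul _]
    refine Finset.sum_congr rfl fun j _ => ?_
    rw [integral_const_mul, gaussianWidth_eq_integral hκ (separationSet_nonempty _ _) (hFY i j)]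
  rw [hint]
  refine integral_nonpos fun f => sum_mul_ultrametric_nonpos (fun i j => M i j f)
    (fun i j => (hMsymm f i j).antisymm (hMsymm f j i)) (fun i j k => ciSup_le ?_) c hc
  rintro ⟨x, hx⟩
  have : x ∈ F i j ∨ x ∈ F j k := by
    simp only [F, mem_separationSet] at hx ⊢
    by_contra! h
    rcases hx with hx | hx | hx
    · exact h.1.1 hx
    · exact h.2.2.1 hx
    · exact hx (h.1.2.2.trans h.2.2.2)
  exact this.elim (fun h => le_max_of_le_left (hle f i j x h))
    (fun h => le_max_of_le_right (hle f j k x h))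

theorem isCNDFunction_finsum {H X : Type*} [Group H] {ψ : H → ℝ} (hψ : IsCNDFunction ψ) :
    IsCNDFunction fun w : FinSuppSubgroup H X => ∑ᶠ x, ψ ((w : X → H) x) := by
  classical
  refine ⟨fun v w => finsum_congr fun x => ?_, fun w => ?_, fun n w c hc => ?_⟩
  · simpa using hψ.1 ((v : X → H) x) ((w : X → H) x)
  · simp [hψ.map_one]
  let Y : Finset X := Finset.univ.biUnion fun i => finSupp (w i)
  have hY (i : Fin n) (x : X) (hx : x ∉ Y) : (w i : X → H) x = 1 := by
    by_contra h
    exact hx (Finset.mem_biUnion.2 ⟨i, Finset.mem_univ i, mem_finSupp.2 h⟩)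
  have hsum (i j : Fin n) : ∑ᶠ x, ψ ((((w i)⁻¹ * w j : FinSuppSubgroup H X) : X → H) x) =
      ∑ x ∈ Y, ψ (((w i : X → H) x)⁻¹ * (w j : X → H) x) := by
    refine finsum_eq_sum_of_support_subset _ fun x hx => ?_
    by_contra h
    exact hx (by simp [hY i x h, hY j x h, hψ.map_one])
  change ∑ i, ∑ j, c i * c j * ∑ᶠ x, ψ ((((w i)⁻¹ * w j : FinSuppSubgroup H X) : X → H) x) ≤ 0
  simp_rw [hsum, Finset.mul_sum]
  simp_rw [Finset.sum_comm (s := Finset.univ) (t := Y)]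
  exact Finset.sum_nonpos fun x _ => hψ.2.2 n (fun i => (w i : X → H) x) c hc

theorem finite_setOf_finSupp_subset {H X : Type*} [Group H] {B : Set X} (hB : B.Finite)
    {S : Set H} (hS : S.Finite) :
    {w : FinSuppSubgroup H X | ∀ x, (w : X → H) x ∈ S ∧ (x ∉ B → (w : X → H) x = 1)}.Finite := by
  have : Finite B := hB
  refine Set.Finite.of_injOn (f := fun (w : FinSuppSubgroup H X) (b : B) => (w : X → H) b)
    (t := Set.pi univ fun _ => S) (fun w hw b _ => (hw b).1) (fun v hv w hw h => ?_)
    (Set.Finite.pi fun _ => hS)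
  ext x
  by_cases hx : x ∈ B
  · exact congrFun h ⟨x, hx⟩
  · rw [(hv x).2 hx, (hw x).2 hx]

theorem wreathShift_apply {H X G : Type*} [Group H] [Group G] [MulAction G X] (g : G)
    (w : FinSuppSubgroup H X) (x : X) :
    (wreathShift H X G g w : X → H) x = (w : X → H) (g⁻¹ • x) := rfl

theorem PermWreath.inv_mul_left {H X G : Type*} [Group H] [Group G] [MulAction G X]
    (p q : PermWreath H X G) :
    (p⁻¹ * q).left = wreathShift H X G p.right⁻¹ (p.left⁻¹ * q.left) := by
  simp

theorem isCNDFunction_finsum_left {H X G : Type*} [Group H] [Group G] [MulAction G X]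
    {ψ : H → ℝ} (hψ : IsCNDFunction ψ) :
    IsCNDFunction fun p : PermWreath H X G => ∑ᶠ x, ψ ((p.left : X → H) x) := by
  have h := IsCNDKernel.comp (isCNDFunction_finsum (X := X) hψ)
    (fun p : PermWreath H X G => p.left)
  unfold IsCNDFunction
  convert h using 3 with p q
  change ∑ᶠ x, ψ (((p⁻¹ * q).left : X → H) x) = _
  rw [PermWreath.inv_mul_left]
  simp_rw [wreathShift_apply]
  exact finsum_comp_equiv (MulAction.toPerm p.right⁻¹⁻¹)
    (f := fun x => ψ (((p.left⁻¹ * q.left : FinSuppSubgroup H X) : X → H) x))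

theorem isCNDFunction_gaussianWidth {H X G : Type*} [Group H] [Group G] [MulAction G X]
    [DecidableEq X] {κ : X → X → ℝ} (hκ : IsCNDKernel κ)
    (hinv : ∀ (g : G) (a b : X), κ (g • a) (g • b) = κ a b) (x₀ : X) :
    IsCNDFunction fun p : PermWreath H X G =>
      gaussianWidth κ (separationSet (1, x₀) (p.left, p.right • x₀)) := by
  have h := (isCNDKernel_gaussianWidth_separationSet (H := H) hκ).comp
    (fun p : PermWreath H X G => (p.left, p.right • x₀))
  unfold IsCNDFunction
  convert h using 3 with p q
  change gaussianWidth κ (separationSet (1, x₀) ((p⁻¹ * q).left, (p⁻¹ * q).right • x₀)) =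
    gaussianWidth κ (separationSet (p.left, p.right • x₀) (q.left, q.right • x₀))
  rw [← gaussianWidth_image hκ (separationSet_nonempty _ _) (hinv p.right)]
  congr 1
  ext x
  have hmem (F : Finset X) : x ∈ F.image (p.right • ·) ↔ p.right⁻¹ • x ∈ F := by
    rw [Finset.mem_image]
    exact ⟨by rintro ⟨y, hy, rfl⟩; simpa, fun h => ⟨_, h, smul_inv_smul _ _⟩⟩
  rw [hmem, mem_separationSet, mem_separationSet, PermWreath.inv_mul_left]
  simp only [wreathShift_apply, SemidirectProduct.mul_right, SemidirectProduct.inv_right, mul_smul,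
    inv_inv, smul_inv_smul, inv_smul_eq_iff, OneMemClass.coe_one, Pi.one_apply, Subgroup.coe_mul,
    Subgroup.coe_inv, Pi.mul_apply, Pi.inv_apply, ne_eq, eq_comm (a := (1 : H)), inv_mul_eq_one]

/-- **Theorem.** Let `H`, `G` be countable Haagerup groups (each with a proper conditionally
negative definite function) and let `L ≤ G` be a co-Haagerup subgroup, i.e. `G/L` carries a
`G`-invariant proper conditionally negative definite kernel. Then the permutational wreath
product `H ≀_{G/L} G = H^{(G/L)} ⋊ G` admits a proper conditionally negative definite
function. -/
theorem perm_wreath_haagerup {H G : Type*} [Group H] [Group G] [Countable H] [Countable G]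
    (L : Subgroup G)
    (κ : G ⧸ L → G ⧸ L → ℝ) (hκ : IsCNDKernel κ)
    (hκinv : ∀ (g : G) (a b : G ⧸ L), κ (g • a) (g • b) = κ a b)
    (hκprop : ∀ (a : G ⧸ L) (R : ℝ), {b : G ⧸ L | κ a b ≤ R}.Finite)
    (hH : ∃ ψ : H → ℝ, IsCNDFunction ψ ∧ IsProperFunction ψ)
    (hG : ∃ ψ : G → ℝ, IsCNDFunction ψ ∧ IsProperFunction ψ) :
    ∃ ψ : PermWreath H (G ⧸ L) G → ℝ, IsCNDFunction ψ ∧ IsProperFunction ψ := by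
  classical
  obtain ⟨ψH, hψH, hψHprop⟩ := hH
  obtain ⟨ψG, hψG, hψGprop⟩ := hG
  let x₀ : G ⧸ L := (1 : G)
  have hW := isCNDFunction_gaussianWidth (H := H) hκ hκinv x₀
  have hS := isCNDFunction_finsum_left (X := G ⧸ L) (G := G) hψH
  have hR : IsCNDFunction fun p : PermWreath H (G ⧸ L) G => ψG p.right := by
    exact IsCNDKernel.comp hψG fun p : PermWreath H (G ⧸ L) G => p.right
  refine ⟨_, (hW.add hS).add hR, fun R => ?_⟩
  set C : ℝ := (∫ x, |x| ∂(ProbabilityTheory.gaussianReal 0 1)) / 2 with hC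
  have hCpos : 0 < C := half_pos integral_abs_gaussianReal_pos
  refine Set.Finite.of_injOn (f := fun p => (p.left, p.right)) ?_
    (fun p _ q _ h => SemidirectProduct.ext (congrArg Prod.fst h) (congrArg Prod.snd h))
    ((finite_setOf_finSupp_subset (hκprop x₀ ((R / C) ^ 2)) (hψHprop R)).prod (hψGprop R))
  intro p hp
  have hp' : gaussianWidth κ (separationSet (1, x₀) (p.left, p.right • x₀)) +
    ∑ᶠ x, ψH ((p.left : G ⧸ L → H) x) + ψG p.right ≤ R := hp
  have hWp := hW.nonneg p
  have hSp := hS.nonneg p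
  have hRp := hR.nonneg p
  refine ⟨fun x => ⟨?_, fun hx => ?_⟩, ?_⟩
  · have hfin : (support fun x => ψH ((p.left : G ⧸ L → H) x)).Finite :=
      Set.Finite.subset p.left.2 fun x hx h => hx (by simp only [h, hψH.map_one])
    have := single_le_finsum x hfin fun x => hψH.nonneg _
    change ψH _ ≤ R
    linarith
  · by_contra h
    refine hx ?_
    have hmem : x ∈ separationSet (1, x₀) (p.left, p.right • x₀) :=
      mem_separationSet.2 (.inr (.inr (Ne.symm h)))
    have hbound := sqrt_mul_le_gaussianWidth hκ
      (mem_separationSet.2 (.inl rfl) : x₀ ∈ separationSet (1, x₀) (p.left, p.right • x₀)) hmem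
    have hsqrt : √(κ x₀ x) ≤ R / C := by
      rw [← hC] at hbound
      rw [le_div_iff₀ hCpos]
      linarith
    exact (Real.sqrt_le_left ((Real.sqrt_nonneg _).trans hsqrt)).1 hsqrt
  · change ψG p.right ≤ R
    linarith
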